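/- arXiv:2003.13539 — 2 statements merged into one kernel-verified Lean document; each statement's English description precedes it below -/
import Mathlib

section
/- For every u₀ ∈ (0,1) there exists A₀ > 0 such that for all real parameters a, b, c with a > 0, 0 < b < 1, −b < c < a and ab ≥ A₀, and for every u with |c|/b < u ≤ u₀, one has |√(ab)·F_{a,b,c}(u) + ln u| ≤ M(u₀). In other words, F_{a,b,c}(u) = h_{a,b,c}(u)/√(ab) − (ln u)/√(ab) with a function h_{a,b,c} bounded in absolute value by M(u₀) on (|c|/b, u₀]. -/
open Real MeasureTheory intervalIntegral

/-- The Abelian integral `F_{a,b,c}(u) = ∫_u^1 (1−bx)/√(x(1−x)(a+bx)(c+bx)) dx`. -/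
noncomputable def F (a b c u : ℝ) : ℝ :=
  ∫ x in u..1, (1 - b * x) / Real.sqrt (x * (1 - x) * (a + b * x) * (c + b * x))

/-- The bound function `M(u₀) = 2·ln(1+√2)/√(1−u₀) + 2·ln 2`. -/
noncomputable def M (u₀ : ℝ) : ℝ :=
  2 * Real.log (1 + Real.sqrt 2) / Real.sqrt (1 - u₀) + 2 * Real.log 2

/-- Key algebraic inequality. -/
lemma key_ineq (u L al be : ℝ) (hL : 1 ≤ L) (hal : 0 < al) (hbe : 0 < be)
    (hrel : (1 - al ^ 2) * (1 - be ^ 2) = u)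
    (m : ℝ) (hm : 0 < m) (hmu : (1 - m ^ 2) ^ 2 = u) (hm1 : m < 1)
    (hal1 : al ≤ 1) (hbe1 : be ≤ 1)
    (h1 : 1 ≤ L ^ 2 * (1 - u)) (h2 : 1 + m ≤ 2 * m * L) :
    1 / (al * be) ≤ (1 - 2 * L) + L * (1 / al + 1 / be) := by
  have hP : 0 < al * be := mul_pos hal hbe
  have hPm : al * be ≤ m ^ 2 := by
    by_contra hcon
    push Not at hcon
    have hP1 : al * be ≤ 1 := by nlinarith
    have e1 : (1 - al * be) ^ 2 ≥ (1 - m ^ 2) ^ 2 := by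
      rw [hmu, ← hrel]; nlinarith [sq_nonneg (al - be)]
    nlinarith
  have main : 1 + (2 * L - 1) * (al * be) ≤ L * (al + be) := by
    have hs : (L * (al + be)) ^ 2 = L ^ 2 * ((1 + al * be) ^ 2 - u) := by
      rw [← hrel]; ring
    refine le_of_sq_le_sq ?_ (by positivity)
    rw [hs]
    generalize al * be = P at *
    -- endpoint P = m ^ 2
    have h3 : (1 + (2 * L - 1) * m ^ 2) ^ 2 ≤ L ^ 2 * ((1 + m ^ 2) ^ 2 - u) := by
      have : L ^ 2 * ((1 + m ^ 2) ^ 2 - u) = (2 * m * L) ^ 2 := by rw [← hmu]; ring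
      rw [this]
      apply pow_le_pow_left₀
      · nlinarith [sq_nonneg m]
      · nlinarith [mul_nonneg (sub_nonneg.2 hm1.le) (sub_nonneg.2 h2)]
    have hc : 0 ≤ (2 * L - 1) ^ 2 - L ^ 2 := by nlinarith
    have hm2 : 0 < m ^ 2 := by positivity
    have key : 0 ≤ m ^ 2 * (L ^ 2 * ((1 + P) ^ 2 - u) - (1 + (2 * L - 1) * P) ^ 2) := by
      have a1 := mul_nonneg (sub_nonneg.2 hPm) (sub_nonneg.2 h1)
      have a2 := mul_nonneg hP.le (sub_nonneg.2 h3)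
      have a3 := mul_nonneg hc (mul_nonneg hm2.le (mul_nonneg hP.le (sub_nonneg.2 hPm)))
      nlinarith
    have := nonneg_of_mul_nonneg_right key hm2
    linarith
  rw [div_le_iff₀ hP]
  have : ((1 - 2 * L) + L * (1 / al + 1 / be)) * (al * be)
      = (1 - 2 * L) * (al * be) + L * (al + be) := by
    field_simp
    ring
  rw [this]; linarith

/-- The antiderivative of the dominating function. -/
noncomputable def Phi (u L x : ℝ) : ℝ :=
  Real.log x + 2 * L * (Real.log (1 + √(1 - u / x)) - Real.log (1 + √(1 - x)))

/-- The dominating function. -/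
noncomputable def G (u L x : ℝ) : ℝ :=
  1 / x * ((1 - 2 * L) + L * (1 / √(1 - x) + 1 / √(1 - u / x)))

lemma Phi_deriv (u L x : ℝ) (hu : 0 < u) (hx : u < x) (hx1 : x < 1) :
    HasDerivAt (Phi u L) (G u L x) x := by
  have hx0 : 0 < x := hu.trans hx
  have hq : 0 < 1 - u / x := by
    rw [sub_pos, div_lt_one hx0]; exact hx
  have hp : 0 < 1 - x := by linarith
  have ha : 0 < √(1 - x) := Real.sqrt_pos.2 hp
  have hb : 0 < √(1 - u / x) := Real.sqrt_pos.2 hq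
  have d1 : HasDerivAt (fun y : ℝ => 1 - y) (-1) x := by
    simpa using (hasDerivAt_id x).const_sub 1
  have d2 : HasDerivAt (fun y : ℝ => 1 - u / y) (u / x ^ 2) x := by
    have := ((hasDerivAt_inv hx0.ne').const_mul u).const_sub 1
    simp only [← div_eq_mul_inv] at this
    refine this.congr_deriv ?_
    ring
  have e1 := ((d1.sqrt hp.ne').const_add 1).log (by positivity)
  have e2 := ((d2.sqrt hq.ne').const_add 1).log (by positivity)
  have e3 := (Real.hasDerivAt_log hx0.ne').add ((e2.sub e1).const_mul (2 * L))
  refine HasDerivAt.congr_deriv (f := Phi u L) e3 ?_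
  unfold G
  symm
  have r1 : x = 1 - √(1 - x) ^ 2 := by rw [Real.sq_sqrt hp.le]; ring
  have r2 : u = x * (1 - √(1 - u / x) ^ 2) := by rw [Real.sq_sqrt hq.le]; field_simp; ring
  generalize √(1 - x) = al at *
  generalize √(1 - u / x) = be at *
  have t1 : 1 / x * (1 / al - 1) = 1 / (al * (1 + al)) := by
    have : 1 - al ^ 2 ≠ 0 := by rw [← r1]; exact hx0.ne'
    rw [r1]; field_simp; ring
  have t2 : u / x ^ 2 / (be * (1 + be)) = 1 / x * (1 / be - 1) := by
    rw [r2]; field_simp; ring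
  have l : 1 / x * (1 - 2 * L + L * (1 / al + 1 / be))
    = 1 / x + L * (1 / x * (1 / be - 1)) + L * (1 / x * (1 / al - 1)) := by ring
  rw [l, ← t2, t1]
  field_simp
  ring

lemma Phi_cont (u L : ℝ) (hu : 0 < u) : ContinuousOn (Phi u L) (Set.Icc u 1) := by
  unfold Phi
  have hne : ∀ x ∈ Set.Icc u 1, x ≠ 0 := fun x hx => (hu.trans_le hx.1).ne'
  refine ContinuousOn.add (Real.continuousOn_log.mono fun x hx => hne x hx) ?_
  refine continuousOn_const.mul (ContinuousOn.sub ?_ ?_)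
  · refine ContinuousOn.log ?_ (fun x _ => by positivity)
    refine continuousOn_const.add (ContinuousOn.sqrt ?_)
    exact continuousOn_const.sub (continuousOn_const.div continuousOn_id hne)
  · refine ContinuousOn.log ?_ (fun x _ => by positivity)
    exact Continuous.continuousOn (by fun_prop)

/-- Pointwise upper bound. -/
lemma upper_pt (a b c u L m x : ℝ) (ha : 0 < a) (hb : 0 < b) (hb1 : b < 1)
    (hc : -(b * u) ≤ c) (hu : 0 < u) (hx : u < x) (hx1 : x < 1) (hL : 1 ≤ L)
    (hm : 0 < m) (hmu : (1 - m ^ 2) ^ 2 = u) (hm1 : m < 1)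
    (h1 : 1 ≤ L ^ 2 * (1 - u)) (h2 : 1 + m ≤ 2 * m * L) :
    √(a * b) * ((1 - b * x) / √(x * (1 - x) * (a + b * x) * (c + b * x))) ≤ G u L x := by
  have hx0 : 0 < x := hu.trans hx
  have hq : 0 < 1 - u / x := by
    rw [sub_pos, div_lt_one hx0]; exact hx
  have hp : 0 < 1 - x := by linarith
  have hal : 0 < √(1 - x) := Real.sqrt_pos.2 hp
  have hbe : 0 < √(1 - u / x) := Real.sqrt_pos.2 hq
  have hab : 0 < √(a * b) := Real.sqrt_pos.2 (by positivity)
  have K := key_ineq u L _ _ hL hal hbe (by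
    rw [Real.sq_sqrt hp.le, Real.sq_sqrt hq.le]; field_simp; ring) m hm hmu hm1
    (Real.sqrt_le_one.2 (by linarith)) (Real.sqrt_le_one.2 (by
      have : 0 < u / x := by positivity
      linarith)) h1 h2
  have hD : √(a * b) * (x * (√(1 - x) * √(1 - u / x)))
      ≤ √(x * (1 - x) * (a + b * x) * (c + b * x)) := by
    apply Real.le_sqrt_of_sq_le
    have : (√(a * b) * (x * (√(1 - x) * √(1 - u / x)))) ^ 2
      = a * b * (x ^ 2 * ((1 - x) * (1 - u / x))) := by
      rw [mul_pow, mul_pow, mul_pow, Real.sq_sqrt (by positivity), Real.sq_sqrt hp.le,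
        Real.sq_sqrt hq.le]
    rw [this]
    have e : a * b * (x ^ 2 * ((1 - x) * (1 - u / x))) = x * (1 - x) * (a * (b * (x - u))) := by
      field_simp
    rw [e, mul_assoc (x * (1 - x))]
    apply mul_le_mul_of_nonneg_left _ (by positivity)
    apply mul_le_mul _ _ (mul_nonneg hb.le (by linarith)) (by positivity)
    · have : 0 < b * x := by positivity
      linarith
    · linarith
  have hpos : 0 < √(a * b) * (x * (√(1 - x) * √(1 - u / x))) := by positivity
  have hbx : 0 < b * x := by positivity
  calc √(a * b) * ((1 - b * x) / √(x * (1 - x) * (a + b * x) * (c + b * x)))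
      ≤ √(a * b) * (1 / (√(a * b) * (x * (√(1 - x) * √(1 - u / x))))) := by
        apply mul_le_mul_of_nonneg_left _ hab.le
        apply div_le_div₀ zero_le_one (by linarith) hpos hD
    _ = 1 / x * (1 / (√(1 - x) * √(1 - u / x))) := by field_simp
    _ ≤ G u L x := by
        unfold G
        exact mul_le_mul_of_nonneg_left K (by positivity)

/-- Pointwise lower bound. -/
lemma lower_pt (a b c u x : ℝ) (ha : 0 < a) (hb : 0 < b) (hb1 : b < 1) (hba : b ≤ a)
    (hc : -(b * u) < c) (hc' : c ≤ b * u) (hu : 0 < u) (hx : u < x) (hx1 : x < 1) :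
    1 / x - u / (2 * x ^ 2) - 1 ≤
      √(a * b) * ((1 - b * x) / √(x * (1 - x) * (a + b * x) * (c + b * x))) := by
  have hx0 : 0 < x := hu.trans hx
  have hp : 0 < 1 - x := by linarith
  have hab : 0 < √(a * b) := Real.sqrt_pos.2 (by positivity)
  have hcx : 0 < c + b * x := by nlinarith
  have hDpos : 0 < √(x * (1 - x) * (a + b * x) * (c + b * x)) :=
    Real.sqrt_pos.2 (by positivity)
  have hD : √(x * (1 - x) * (a + b * x) * (c + b * x)) ≤ √(a * b) * (x + u / 2) := by
    apply Real.sqrt_le_iff.2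
    refine ⟨by positivity, ?_⟩
    rw [mul_pow, Real.sq_sqrt (by positivity)]
    have s1 : (a + b * x) * (c + b * x) ≤ (a * (1 + x)) * (b * (x + u)) := by
      apply mul_le_mul _ _ hcx.le (by positivity)
      · nlinarith
      · linarith
    calc x * (1 - x) * (a + b * x) * (c + b * x)
        = x * (1 - x) * ((a + b * x) * (c + b * x)) := by ring
      _ ≤ x * (1 - x) * ((a * (1 + x)) * (b * (x + u))) :=
          mul_le_mul_of_nonneg_left s1 (by positivity)
      _ = a * b * ((1 - x ^ 2) * (x * (x + u))) := by ring
      _ ≤ a * b * (x + u / 2) ^ 2 := by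
          apply mul_le_mul_of_nonneg_left _ (by positivity)
          have : 0 < x ^ 2 * (x * (x + u)) := by positivity
          nlinarith [sq_nonneg u]
  have hbx : b * x ≤ x := by nlinarith
  calc 1 / x - u / (2 * x ^ 2) - 1 ≤ (1 - x) / (x + u / 2) := by
        rw [le_div_iff₀ (by positivity)]
        have : (1 / x - u / (2 * x ^ 2) - 1) * (x + u / 2)
          = 1 - x - u ^ 2 / (4 * x ^ 2) - u / 2 := by
          field_simp
          ring
        rw [this]
        have : 0 < u ^ 2 / (4 * x ^ 2) := by positivity
        linarith
    _ = √(a * b) * ((1 - x) / (√(a * b) * (x + u / 2))) := by field_simp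
    _ ≤ _ := by
        apply mul_le_mul_of_nonneg_left _ hab.le
        apply div_le_div₀ (by linarith) (by linarith) hDpos hD

lemma log_one_sqrt : (0.85 : ℝ) ≤ Real.log (1 + √2) := by
  have h2 : (1.4 : ℝ) ≤ √2 := Real.le_sqrt_of_sq_le (by norm_num)
  have h3 : Real.log (2 * 1.2) ≤ Real.log (1 + √2) :=
    Real.log_le_log (by norm_num) (by linarith)
  rw [Real.log_mul (by norm_num) (by norm_num)] at h3
  have := Real.one_sub_inv_le_log_of_pos (show (0 : ℝ) < 1.2 by norm_num)
  have := Real.log_two_gt_d9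
  norm_num at *
  linarith

lemma log_bound (s : ℝ) (hs : 0 < s) : Real.log (1 + s) ≤ Real.log 2 + (s - 1) / 2 := by
  have h := Real.log_le_sub_one_of_pos (show 0 < (1 + s) / 2 by positivity)
  rw [Real.log_div (by positivity) (by norm_num)] at h
  linarith

/-- Choice of the constant `L`. -/
lemma exists_L (u : ℝ) (hu : 0 < u) (hu1 : u < 1) : ∃ L m : ℝ, 1 ≤ L ∧ 0 < m ∧
    (1 - m ^ 2) ^ 2 = u ∧ m < 1 ∧ 1 ≤ L ^ 2 * (1 - u) ∧ 1 + m ≤ 2 * m * L ∧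
    4 * L * Real.log (1 + √(1 - u)) ≤ M u := by
  obtain ⟨v, hv, rfl⟩ : ∃ v, 0 < v ∧ v ^ 2 = u :=
    ⟨√u, Real.sqrt_pos.2 hu, Real.sq_sqrt hu.le⟩
  have hv1 : v < 1 := by nlinarith
  have hm2 : √(1 - v) ^ 2 = 1 - v := Real.sq_sqrt (by linarith)
  have hm : 0 < √(1 - v) := Real.sqrt_pos.2 (by linarith)
  have hs2 : √(1 - v ^ 2) ^ 2 = 1 - v ^ 2 := Real.sq_sqrt (by linarith)
  have hs : 0 < √(1 - v ^ 2) := Real.sqrt_pos.2 (by linarith)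
  unfold M
  set m := √(1 - v)
  set s := √(1 - v ^ 2)
  have hm1 : m < 1 := by nlinarith
  have hs1 : s < 1 := by nlinarith
  have l2 := Real.log_two_gt_d9
  have l2' := Real.log_two_lt_d9
  have lq := log_one_sqrt
  have lb := log_bound s hs
  have l0 : 0 < Real.log (1 + s) := Real.log_pos (by linarith)
  refine ⟨max (1 / s) ((1 + m) / (2 * m)), m, ?_, hm, ?_, hm1, ?_, ?_, ?_⟩
  · exact le_max_of_le_left ((one_le_div hs).2 hs1.le)
  · rw [hm2]; ring
  · rw [← hs2, ← mul_pow]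
    apply one_le_pow₀
    rw [← div_le_iff₀ hs]
    exact le_max_left _ _
  · have := le_max_right (1 / s) ((1 + m) / (2 * m))
    rw [div_le_iff₀ (by positivity)] at this
    linarith
  · rcases max_choice (1 / s) ((1 + m) / (2 * m)) with h | h <;> rw [h]
    · have : 4 * Real.log (1 + s) ≤ 2 * Real.log (1 + √2) + 2 * Real.log 2 * s := by
        nlinarith
      calc 4 * (1 / s) * Real.log (1 + s) = (4 * Real.log (1 + s)) / s := by ring
        _ ≤ (2 * Real.log (1 + √2) + 2 * Real.log 2 * s) / s := by gcongr
        _ = _ := by field_simp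
    · have e : 4 * ((1 + m) / (2 * m)) * Real.log (1 + s)
        = 2 * (Real.log (1 + s) / m) + 2 * Real.log (1 + s) := by field_simp; ring
      rw [e]
      have a1 : Real.log (1 + s) ≤ Real.log 2 := by linarith
      have a2 : Real.log (1 + s) / m ≤ Real.log (1 + √2) / s := by
        rw [div_le_div_iff₀ hm hs]
        have b1 : s ≤ (1 + v / 2) * m := by
          apply le_of_sq_le_sq _ (by positivity)
          rw [mul_pow, hs2, hm2]
          nlinarith [mul_pos (pow_pos hv 2) (sub_pos.2 hv1)]
        have b2 : s ≤ 1 - v ^ 2 / 2 := by nlinarith [sq_nonneg (s - 1)]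
        have b3 : Real.log (1 + s) * (1 + v / 2) ≤ Real.log (1 + √2) := by
          have : Real.log (1 + s) ≤ 0.6932 - v ^ 2 / 4 := by linarith
          nlinarith [mul_le_mul_of_nonneg_right this (show 0 ≤ 1 + v / 2 by positivity),
            sq_nonneg (v - 0.7), pow_pos hv 3]
        calc Real.log (1 + s) * s ≤ Real.log (1 + s) * ((1 + v / 2) * m) := by gcongr
          _ = (Real.log (1 + s) * (1 + v / 2)) * m := by ring
          _ ≤ _ := by gcongr
      have : 2 * Real.log (1 + √2) / s = 2 * (Real.log (1 + √2) / s) := by ring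
      rw [this]
      linarith

lemma M_mono (u v : ℝ) (h : u ≤ v) (hv : v < 1) : M u ≤ M v := by
  unfold M
  have lq := log_one_sqrt
  have : 0 < √(1 - v) := Real.sqrt_pos.2 (by linarith)
  have : √(1 - v) ≤ √(1 - u) := Real.sqrt_le_sqrt (by linarith)
  gcongr

lemma M_lower (u : ℝ) (h : 0 < u) (hv : u < 1) : 3 / 2 ≤ M u := by
  have l2 := Real.log_two_gt_d9
  have lq := log_one_sqrt
  unfold M
  have h0 : 0 < √(1 - u) := Real.sqrt_pos.2 (by linarith)
  have h1 : √(1 - u) ≤ 1 := Real.sqrt_le_one.2 (by linarith)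
  have : 2 * Real.log (1 + √2) ≤ 2 * Real.log (1 + √2) / √(1 - u) := by
    rw [le_div_iff₀ h0]; nlinarith
  linarith

/-- For every `u₀ ∈ (0,1)`, for `ab` large enough, and for every `u` with
`|c|/b < u ≤ u₀`, one has `|√(ab)·F_{a,b,c}(u) + ln u| ≤ M(u₀)`; i.e.
`F_{a,b,c}(u) = h(u)/√(ab) − (ln u)/√(ab)` with `|h| ≤ M(u₀)` on `(|c|/b, u₀]`. -/
theorem F_log_decomposition :
    ∀ u₀ ∈ Set.Ioo (0 : ℝ) 1, ∃ A₀ > (0 : ℝ), ∀ a b c : ℝ,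
      0 < a → 0 < b → b < 1 → -b < c → c < a → A₀ ≤ a * b →
      ∀ u : ℝ, |c| / b < u → u ≤ u₀ →
        |Real.sqrt (a * b) * F a b c u + Real.log u| ≤ M u₀ := by
  intro u₀ hu₀
  refine ⟨1, one_pos, ?_⟩
  intro a b c ha hb hb1 _ _ hab u hcu huu
  have hu : 0 < u := lt_of_le_of_lt (by positivity) hcu
  have hu1 : u < 1 := lt_of_le_of_lt huu hu₀.2
  have hba : b ≤ a := by nlinarith
  rw [div_lt_iff₀ hb, abs_lt] at hcu
  obtain ⟨hc1, hc2⟩ := hcu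
  obtain ⟨L, m, hL, hm, hmu, hm1, h1, h2, hM⟩ := exists_L u hu hu1
  refine le_trans ?_ (M_mono u u₀ huu hu₀.2)
  set g : ℝ → ℝ := fun x =>
    √(a * b) * ((1 - b * x) / √(x * (1 - x) * (a + b * x) * (c + b * x))) with hg
  have hF : √(a * b) * F a b c u = ∫ x in u..1, g x := by
    unfold F
    rw [hg, intervalIntegral.integral_const_mul]
  have up : ∀ x ∈ Set.Ioo u 1, g x ≤ G u L x := fun x hx =>
    upper_pt a b c u L m x ha hb hb1 (by linarith) hu hx.1 hx.2 hL hm hmu hm1 h1 h2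
  have lo : ∀ x ∈ Set.Ioo u 1, 1 / x - u / (2 * x ^ 2) - 1 ≤ g x := fun x hx =>
    lower_pt a b c u x ha hb hb1 hba (by linarith) (by linarith) hu hx.1 hx.2
  have g0 : ∀ x ∈ Set.Ioo u 1, 0 ≤ g x := fun x hx => by
    have : b * x ≤ 1 := by nlinarith [hx.1, hx.2]
    exact mul_nonneg (Real.sqrt_nonneg _) (div_nonneg (by linarith) (Real.sqrt_nonneg _))
  have hGi : IntervalIntegrable (G u L) volume u 1 := by
    rw [intervalIntegrable_iff_integrableOn_Ioc_of_le hu1.le]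
    exact integrableOn_deriv_of_nonneg (Phi_cont u L hu)
      (fun x hx => Phi_deriv u L x hu hx.1 hx.2) (fun x hx => (g0 x hx).trans (up x hx))
  have hGint : ∫ x in u..1, G u L x = Phi u L 1 - Phi u L u :=
    integral_eq_sub_of_hasDerivAt_of_le hu1.le (Phi_cont u L hu)
      (fun x hx => Phi_deriv u L x hu hx.1 hx.2) hGi
  have hgi : IntervalIntegrable g volume u 1 := by
    rw [intervalIntegrable_iff_integrableOn_Ioo_of_le hu1.le] at hGi ⊢
    refine Integrable.mono' hGi ?_ ?_
    · apply Measurable.aestronglyMeasurable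
      rw [hg]; fun_prop
    · filter_upwards [ae_restrict_mem measurableSet_Ioo] with x hx
      rw [Real.norm_of_nonneg (g0 x hx)]
      exact up x hx
  have hne : ∀ x ∈ Set.uIcc u 1, x ≠ 0 := fun x hx => by
    rw [Set.uIcc_of_le hu1.le] at hx
    exact (hu.trans_le hx.1).ne'
  have hli : IntervalIntegrable (fun x : ℝ => 1 / x - u / (2 * x ^ 2) - 1) volume u 1 := by
    apply ContinuousOn.intervalIntegrable
    have h' : ∀ x ∈ Set.uIcc u 1, 2 * x ^ 2 ≠ 0 := fun x hx => by
      have := hne x hx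
      positivity
    exact ((continuousOn_const.div continuousOn_id hne).sub
      (continuousOn_const.div (Continuous.continuousOn (by fun_prop)) h')).sub continuousOn_const
  have hlint : ∫ x in u..1, (1 / x - u / (2 * x ^ 2) - 1)
      = (Real.log 1 + u / 2 * (1 : ℝ)⁻¹ - 1) - (Real.log u + u / 2 * u⁻¹ - u) := by
    refine integral_eq_sub_of_hasDerivAt (f := fun x => Real.log x + u / 2 * x⁻¹ - x) ?_ hli
    intro x hx
    have hx0 := hne x hx
    have := ((Real.hasDerivAt_log hx0).add ((hasDerivAt_inv hx0).const_mul (u / 2))).sub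
      (hasDerivAt_id x)
    refine this.congr_deriv ?_
    field_simp
    ring
  have i1 : ∫ x in u..1, g x ≤ ∫ x in u..1, G u L x :=
    integral_mono_on_of_le_Ioo hu1.le hgi hGi up
  have i2 : ∫ x in u..1, (1 / x - u / (2 * x ^ 2) - 1) ≤ ∫ x in u..1, g x :=
    integral_mono_on_of_le_Ioo hu1.le hli hgi lo
  rw [hF, abs_le]
  constructor
  · have := M_lower u hu hu1
    rw [hlint, Real.log_one] at i2
    have e : u / 2 * u⁻¹ = 1 / 2 := by field_simp
    rw [e] at i2
    linarith
  · have e : Phi u L 1 - Phi u L u = 4 * L * Real.log (1 + √(1 - u)) - Real.log u := by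
      unfold Phi
      rw [div_self hu.ne']
      simp
      ring
    rw [hGint, e] at i1
    linarith
end

section
/- For all real parameters a, b, c with a > 0, 0 < b < 1, −b < c < a, for every u₀ ∈ (0,1) and every u with |c|/b < u ≤ u₀, the quantity h₁(u) = ∫_u^1 (1/√(x(x + c/b)) − 1/x) · (1 − bx)/√((1−x)(1 + bx/a)) dx satisfies |h₁(u)| ≤ 2 ln(1+√2)/√(1−u₀). -/
open Real MeasureTheory intervalIntegral

lemma aux_log : (0.86 : ℝ) ≤ Real.log (1 + Real.sqrt 2) := by
  have h2 : (1.414 : ℝ) ≤ Real.sqrt 2 := by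
    apply Real.le_sqrt_of_sq_le; norm_num
  rw [Real.le_log_iff_exp_le (by positivity)]
  have h : Real.exp (0.86 : ℝ) ≤ 2.414 := by
    have := Real.exp_bound' (x := (0.86 : ℝ)) (by norm_num) (by norm_num) (n := 6) (by norm_num)
    refine this.trans ?_
    norm_num [Finset.sum_range_succ, Nat.factorial]
  linarith

lemma aux_poly (s : ℝ) (h0 : 0 ≤ s) (h1 : s ≤ 1) :
    s * (π / 2 - s + s ^ 2 * π / 8 - s ^ 3 / 3 + 9 * π / 128 * s ^ 4) ≤ 0.86 := by
  have hp : π ≤ 3.1416 := Real.pi_lt_d4.le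
  have hk : 0 ≤ s * (1 / 2 + s ^ 2 / 8 + 9 / 128 * s ^ 4) := by positivity
  have h3 := mul_le_mul_of_nonneg_left hp hk
  have h4 : s * (3.1416 / 2 - s + s ^ 2 * 3.1416 / 8 - s ^ 3 / 3 + 9 * 3.1416 / 128 * s ^ 4)
      ≤ 0.86 := by
    obtain ⟨t, rfl⟩ : ∃ t, s = 1 - t := ⟨1 - s, by ring⟩
    have ht0 : 0 ≤ t := by linarith
    have ht1 : t ≤ 1 := by linarith
    have := mul_nonneg ht0 h0
    nlinarith [pow_nonneg ht0 2, pow_nonneg ht0 3, pow_nonneg ht0 4, pow_nonneg ht0 5,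
      mul_nonneg ht0 h0, mul_nonneg (pow_nonneg ht0 2) h0, mul_nonneg (pow_nonneg ht0 3) h0,
      mul_nonneg (pow_nonneg ht0 4) h0, mul_nonneg ht0 (sq_nonneg (t - 1/2)),
      mul_nonneg ht0 (sq_nonneg (t^2 - t)), mul_nonneg ht0 (sq_nonneg (t^2 - 1/2))]
  linarith

lemma aux_P (t : ℝ) (h0 : 0 ≤ t) (h1 : t < 1) :
    (1 - t) / Real.sqrt (1 - t ^ 2) ≤
      1 - t + t ^ 2 / 2 - t ^ 3 / 2 + 3 / 8 * t ^ 4 := by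
  have hD : 0 < 1 - t ^ 2 := by nlinarith
  have hP : 0 ≤ 1 - t + t ^ 2 / 2 - t ^ 3 / 2 + 3 / 8 * t ^ 4 := by
    have : 0 ≤ (1 - t) * (1 + t ^ 2 / 2) := mul_nonneg (by linarith) (by positivity)
    have : 0 ≤ t ^ 4 := by positivity
    nlinarith
  rw [div_le_iff₀ (Real.sqrt_pos.2 hD)]
  have h2 : 1 - t ≤ (1 + t) * (1 - t + t ^ 2 / 2 - t ^ 3 / 2 + 3 / 8 * t ^ 4) ^ 2 := by
    have e : (1 + t) * (1 - t + t ^ 2 / 2 - t ^ 3 / 2 + 3 / 8 * t ^ 4) ^ 2 - (1 - t) =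
        t ^ 5 * (1 / 8 + 5 / 8 * (1 - t) + t ^ 2 * (1 / 64 + 15 / 64 * (1 - t))
          + 9 / 64 * t ^ 4) := by ring
    have h1t : 0 ≤ 1 - t := by linarith
    have : 0 ≤ t ^ 5 * (1 / 8 + 5 / 8 * (1 - t) + t ^ 2 * (1 / 64 + 15 / 64 * (1 - t))
          + 9 / 64 * t ^ 4) := by positivity
    linarith
  refine (pow_le_pow_iff_left₀ (sub_nonneg.2 h1.le) (mul_nonneg hP (Real.sqrt_nonneg _)) two_ne_zero).1 ?_
  rw [mul_pow, Real.sq_sqrt hD.le]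
  nlinarith [mul_le_mul_of_nonneg_left h2 (sub_nonneg.2 h1.le)]

lemma aux_diff (x u d : ℝ) (hu : 0 < u) (hux : u < x) (hd : |d| < u) :
    |1 / Real.sqrt (x * (x + d)) - 1 / x| ≤ 1 / Real.sqrt (x * (x - u)) - 1 / x := by
  have hx : 0 < x := hu.trans hux
  obtain ⟨hd1, hd2⟩ := abs_lt.1 hd
  have hm : 0 < x * (x - u) := mul_pos hx (by linarith)
  have hm' : 0 < x * (x + d) := mul_pos hx (by linarith)
  rw [abs_le]
  constructor
  · have e1 : 1 / (x - u / 2) ≤ 1 / Real.sqrt (x * (x - u)) := by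
      apply one_div_le_one_div_of_le (Real.sqrt_pos.2 hm)
      apply Real.sqrt_le_iff.2 ⟨by linarith, by nlinarith⟩
    have e2 : 1 / (x + u / 2) ≤ 1 / Real.sqrt (x * (x + d)) := by
      apply one_div_le_one_div_of_le (Real.sqrt_pos.2 hm')
      apply Real.sqrt_le_iff.2 ⟨by linarith, by nlinarith⟩
    have e3 : 2 / x ≤ 1 / (x - u / 2) + 1 / (x + u / 2) := by
      rw [div_add_div _ _ (by linarith) (by linarith), div_le_div_iff₀ hx
        (mul_pos (by linarith) (by linarith))]
      nlinarith
    have e4 : 2 / x = 1 / x + 1 / x := by ring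
    linarith
  · have : 1 / Real.sqrt (x * (x + d)) ≤ 1 / Real.sqrt (x * (x - u)) := by
      apply one_div_le_one_div_of_le (Real.sqrt_pos.2 hm)
      apply Real.sqrt_le_sqrt
      nlinarith
    linarith

lemma aux_weight (a b x : ℝ) (ha : 0 < a) (hb0 : 0 < b) (hb1 : b < 1) (hx : 0 < x)
    (hx1 : x < 1) :
    |(1 - b * x) / Real.sqrt ((1 - x) * (1 + b * x / a))| ≤ 1 / Real.sqrt (1 - x) := by
  have hbx : b * x < 1 := by nlinarith
  have hbx0 : 0 < b * x := by positivity
  have : 0 < b * x / a := by positivity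
  have h1x : 0 < 1 - x := by linarith
  rw [abs_of_nonneg (div_nonneg (by linarith) (Real.sqrt_nonneg _))]
  apply div_le_div₀ zero_le_one (by linarith) (Real.sqrt_pos.2 h1x)
  apply Real.sqrt_le_sqrt
  nlinarith

lemma aux_int (s : ℝ) : ∫ θ in (0 : ℝ)..(π / 2),
    2 * (1 - s * sin θ + (s * sin θ) ^ 2 / 2 - (s * sin θ) ^ 3 / 2 + 3 / 8 * (s * sin θ) ^ 4) =
    2 * (π / 2 - s + s ^ 2 * π / 8 - s ^ 3 / 3 + 9 * π / 128 * s ^ 4) := by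
  have h : ∀ θ ∈ Set.uIcc (0 : ℝ) (π / 2), HasDerivAt (fun θ : ℝ =>
      2 * (θ + s * cos θ + s ^ 2 / 4 * (θ - sin θ * cos θ) - s ^ 3 / 2 * (cos θ ^ 3 / 3 - cos θ)
       + 3 / 8 * s ^ 4 * (3 / 8 * θ - 3 / 8 * (sin θ * cos θ) - sin θ ^ 3 * cos θ / 4)))
      (2 * (1 - s * sin θ + (s * sin θ) ^ 2 / 2 - (s * sin θ) ^ 3 / 2
        + 3 / 8 * (s * sin θ) ^ 4)) θ := by
    intro θ _
    have hs := Real.hasDerivAt_sin θ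
    have hc := Real.hasDerivAt_cos θ
    have hi := hasDerivAt_id' θ
    have := ((((hi.add (hc.const_mul s)).add ((hi.sub (hs.mul hc)).const_mul (s ^ 2 / 4))).sub
      ((((hc.pow 3).div_const 3).sub hc).const_mul (s ^ 3 / 2))).add
      ((((hi.const_mul (3 / 8)).sub ((hs.mul hc).const_mul (3 / 8))).sub
        (((hs.pow 3).mul hc).div_const 4)).const_mul (3 / 8 * s ^ 4))).const_mul 2
    refine HasDerivAt.congr_deriv this ?_
    have hq : cos θ ^ 2 = 1 - sin θ ^ 2 := Real.cos_sq' θ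
    simp only [Pi.pow_apply]
    push_cast
    ring_nf
    simp only [hq]
    ring
  rw [integral_eq_sub_of_hasDerivAt h (Continuous.intervalIntegrable (by fun_prop) _ _)]
  simp
  ring

theorem h1_bound (a b c u₀ u : ℝ)
    (ha : 0 < a) (hb0 : 0 < b) (hb1 : b < 1) (hcb : -b < c) (hca : c < a)
    (hu₀ : u₀ ∈ Set.Ioo (0 : ℝ) 1) (hu1 : |c| / b < u) (hu2 : u ≤ u₀) :
    |∫ x in u..1,
        (1 / Real.sqrt (x * (x + c / b)) - 1 / x) *
          ((1 - b * x) / Real.sqrt ((1 - x) * (1 + b * x / a)))| ≤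
      2 * Real.log (1 + Real.sqrt 2) / Real.sqrt (1 - u₀) := by
  obtain ⟨hu00, hu01⟩ := hu₀
  have hd : |c / b| < u := by rwa [abs_div, abs_of_pos hb0]
  have hu : 0 < u := (abs_nonneg _).trans_lt hd
  have hu' : u < 1 := by linarith
  obtain ⟨s, hs⟩ : ∃ s, s = Real.sqrt (1 - u) := ⟨_, rfl⟩
  have hs0 : 0 < s := hs ▸ Real.sqrt_pos.2 (by linarith)
  have hs2 : s ^ 2 = 1 - u := by rw [hs, Real.sq_sqrt (by linarith)]
  have hs1 : s < 1 := by nlinarith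
  set f : ℝ → ℝ := fun x => (1 / Real.sqrt (x * (x + c / b)) - 1 / x) *
          ((1 - b * x) / Real.sqrt ((1 - x) * (1 + b * x / a))) with hf
  set φ : ℝ → ℝ := fun θ => u / (1 - s ^ 2 * sin θ ^ 2) with hφ
  set φ' : ℝ → ℝ := fun θ => u * (2 * s ^ 2 * sin θ * cos θ) / (1 - s ^ 2 * sin θ ^ 2) ^ 2 with hφ'
  have hDpos : ∀ θ, 0 < 1 - s ^ 2 * sin θ ^ 2 := by
    intro θ
    have := Real.sin_sq_le_one θ
    nlinarith [sq_nonneg (sin θ), sq_nonneg s]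
  have hder : ∀ θ, HasDerivAt φ (φ' θ) θ := by
    intro θ
    have h1 := (((Real.hasDerivAt_sin θ).pow 2).const_mul (s ^ 2)).const_sub 1
    have h2 := (hasDerivAt_const θ u).div h1 (hDpos θ).ne'
    refine HasDerivAt.congr_deriv h2 ?_
    simp only [hφ']
    congr 1
    push_cast
    ring
  have hpi : 0 < π / 2 := by positivity
  have hsc : ∀ θ ∈ Set.Ioo (0 : ℝ) (π / 2), 0 < sin θ ∧ sin θ < 1 ∧ 0 < cos θ := by
    intro θ hθ
    have h1 : 0 < cos θ := Real.cos_pos_of_mem_Ioo ⟨by linarith [hθ.1], hθ.2⟩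
    have h2 : 0 < sin θ := Real.sin_pos_of_pos_of_lt_pi hθ.1 (by linarith [hθ.2])
    refine ⟨h2, ?_, h1⟩
    nlinarith [Real.sin_sq_add_cos_sq θ]
  have hinj : Set.InjOn φ (Set.Ioo 0 (π / 2)) := by
    intro x hx y hy hxy
    simp only [hφ] at hxy
    rw [div_eq_div_iff (hDpos x).ne' (hDpos y).ne'] at hxy
    have h1 := mul_left_cancel₀ hu.ne' hxy
    have h2 : sin x ^ 2 = sin y ^ 2 := by
      apply mul_left_cancel₀ (pow_pos hs0 2).ne'
      linarith
    have h3 : sin x = sin y := (pow_left_inj₀ (hsc x hx).1.le (hsc y hy).1.le two_ne_zero).1 h2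
    exact Real.injOn_sin ⟨by linarith [hx.1], hx.2.le⟩ ⟨by linarith [hy.1], hy.2.le⟩ h3
  have himg : φ '' Set.Ioo 0 (π / 2) = Set.Ioo u 1 := by
    apply Set.Subset.antisymm
    · rintro _ ⟨θ, hθ, rfl⟩
      obtain ⟨h1, h2, h3⟩ := hsc θ hθ
      have h5 : 0 < s ^ 2 * sin θ ^ 2 := by positivity
      have h6 : sin θ ^ 2 < 1 := by nlinarith
      constructor
      · simp only [hφ]
        rw [lt_div_iff₀ (hDpos θ)]
        nlinarith
      · simp only [hφ]
        rw [div_lt_one (hDpos θ)]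
        nlinarith [pow_pos hs0 2]
    · have hc : ContinuousOn φ (Set.Icc 0 (π / 2)) := fun θ _ =>
        (hder θ).continuousAt.continuousWithinAt
      have := intermediate_value_Ioo hpi.le hc
      have e0 : φ 0 = u := by simp [hφ]
      have e1 : φ (π / 2) = 1 := by
        simp only [hφ, Real.sin_pi_div_two, hs2]
        rw [div_eq_one_iff_eq] <;> linarith
      rwa [e0, e1] at this
  have hcv := integral_image_eq_integral_abs_deriv_smul (s := Set.Ioo 0 (π / 2)) measurableSet_Ioo
    (fun θ _ => (hder θ).hasDerivWithinAt) hinj f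
  rw [himg] at hcv
  rw [intervalIntegral.integral_of_le hu'.le, integral_Ioc_eq_integral_Ioo]
  change |∫ x in Set.Ioo u 1, f x| ≤ _
  rw [hcv]
  have key : |∫ θ in Set.Ioo 0 (π / 2), |φ' θ| • f (φ θ)| ≤
      ∫ θ in Set.Ioo 0 (π / 2), 2 * (1 - s * sin θ + (s * sin θ) ^ 2 / 2 - (s * sin θ) ^ 3 / 2
        + 3 / 8 * (s * sin θ) ^ 4) := by
    rw [← Real.norm_eq_abs]
    apply MeasureTheory.norm_integral_le_of_norm_le
    · apply IntegrableOn.mono_set (t := Set.Icc 0 (π / 2)) _ Set.Ioo_subset_Icc_self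
      exact Continuous.integrableOn_Icc (by fun_prop)
    · refine (ae_restrict_iff' measurableSet_Ioo).2 (Filter.Eventually.of_forall ?_)
      intro θ hθ
      obtain ⟨h1, h2, h3⟩ := hsc θ hθ
      have hmem : φ θ ∈ Set.Ioo u 1 := himg ▸ Set.mem_image_of_mem φ hθ
      obtain ⟨hx1, hx2⟩ := hmem
      have hx0 : 0 < φ θ := hu.trans hx1
      have hfb : |f (φ θ)| ≤ (1 / Real.sqrt (φ θ * (φ θ - u)) - 1 / φ θ)
          * (1 / Real.sqrt (1 - φ θ)) := by
        simp only [hf]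
        rw [abs_mul]
        have := aux_diff (φ θ) u (c / b) hu hx1 hd
        exact mul_le_mul this (aux_weight a b _ ha hb0 hb1 hx0 hx2) (abs_nonneg _)
          ((abs_nonneg _).trans this)
      have hD := hDpos θ
      have hv0 : 0 < s * sin θ := by positivity
      have hv1 : s * sin θ < 1 := by nlinarith
      have hφpos : 0 ≤ φ' θ := by
        simp only [hφ']; positivity
      rw [smul_eq_mul, norm_mul, Real.norm_eq_abs, Real.norm_eq_abs, abs_abs, abs_of_nonneg hφpos]
      have r1 : Real.sqrt (φ θ * (φ θ - u)) = u * (s * sin θ) / (1 - s ^ 2 * sin θ ^ 2) := by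
        rw [Real.sqrt_eq_iff_mul_self_eq_of_pos (by positivity)]
        simp only [hφ]
        field_simp
        ring
      have r2 : Real.sqrt (1 - φ θ) = s * cos θ / Real.sqrt (1 - s ^ 2 * sin θ ^ 2) := by
        have : 1 - φ θ = (s * cos θ) ^ 2 / (1 - s ^ 2 * sin θ ^ 2) := by
          simp only [hφ]
          rw [mul_pow, Real.cos_sq', hs2]
          rw [hs2] at hD
          field_simp
          ring
        rw [this, Real.sqrt_div (sq_nonneg _), Real.sqrt_sq (by positivity)]
      have hP := aux_P (s * sin θ) hv0.le hv1
      rw [mul_pow] at hP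
      calc φ' θ * |f (φ θ)| ≤ φ' θ * ((1 / Real.sqrt (φ θ * (φ θ - u)) - 1 / φ θ)
          * (1 / Real.sqrt (1 - φ θ))) := mul_le_mul_of_nonneg_left hfb hφpos
        _ = 2 * ((1 - s * sin θ) / Real.sqrt (1 - s ^ 2 * sin θ ^ 2)) := by
          rw [r1, r2]
          have hw0 : 0 < Real.sqrt (1 - s ^ 2 * sin θ ^ 2) := Real.sqrt_pos.2 hD
          have hw : 1 - s ^ 2 * sin θ ^ 2 = Real.sqrt (1 - s ^ 2 * sin θ ^ 2) ^ 2 :=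
            (Real.sq_sqrt hD.le).symm
          simp only [hφ, hφ']
          generalize Real.sqrt (1 - s ^ 2 * sin θ ^ 2) = w at *
          rw [hw]
          field_simp
        _ ≤ _ := by
          rw [mul_pow]
          linarith
  rw [← integral_Ioc_eq_integral_Ioo (f := fun θ => 2 * _),
    ← intervalIntegral.integral_of_le hpi.le, aux_int] at key
  refine key.trans ?_
  have hle : Real.sqrt (1 - u₀) ≤ s := hs ▸ Real.sqrt_le_sqrt (by linarith)
  have hlog := aux_log
  have hpos : 0 < Real.sqrt (1 - u₀) := Real.sqrt_pos.2 (by linarith)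
  calc _ ≤ 2 * Real.log (1 + Real.sqrt 2) / s := by
        rw [le_div_iff₀ hs0]
        have := aux_poly s hs0.le hs1.le
        linarith
    _ ≤ _ := by
        apply div_le_div_of_nonneg_left (by linarith) hpos hle
end
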